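/- Suppose every agent uses the same coherent distortion risk measure, i.e., ρ_1 = … = ρ_n = ρ where ρ(Z) = ∫ Z d(T∘ℙ) for a common concave distortion function T. Then every individually rational comonotone allocation is Pareto optimal. -/

import Mathlib

open MeasureTheory ProbabilityTheory Filter

noncomputable section

variable {Ω : Type*} [MeasurableSpace Ω] (μ : MeasureTheory.Measure Ω) [MeasureTheory.IsProbabilityMeasure μ]

/-- The measure is atomless: every set of positive measure has a subset of strictly
smaller positive measure. -/
def AtomlessMeasure : Prop :=
  ∀ s : Set Ω, MeasurableSet s → μ s ≠ 0 →
    ∃ t ⊆ s, MeasurableSet t ∧ 0 < μ t ∧ μ t < μ s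

/-- The space `𝒳 = L^∞` of essentially bounded random variables. -/
abbrev Xinf : Type _ := Lp ℝ ⊤ μ

variable {μ}

/-- Monotone utility functional on `L^∞`. -/
def UMonotone (U : Xinf μ → ℝ) : Prop :=
  ∀ Z₁ Z₂ : Xinf μ, Z₁ ≤ Z₂ → U Z₁ ≤ U Z₂

/-- Translation invariance. -/
def TranslationInvariant (U : Xinf μ → ℝ) : Prop :=
  ∀ (Z : Xinf μ) (c : ℝ), U (Z + Lp.const ⊤ μ c) = U Z + c

/-- Law invariance. -/
def LawInvariant (U : Xinf μ → ℝ) : Prop :=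
  ∀ Z₁ Z₂ : Xinf μ, IdentDistrib (Z₁ : Ω → ℝ) (Z₂ : Ω → ℝ) μ μ → U Z₁ = U Z₂

/-- Positive homogeneity. -/
def PositivelyHomogeneous (U : Xinf μ → ℝ) : Prop :=
  ∀ (Z : Xinf μ) (t : ℝ), 0 ≤ t → U (t • Z) = t * U Z

/-- Concave order `Z₁ ⪯_ccv Z₂`. -/
def ConcaveOrder (Z₁ Z₂ : Xinf μ) : Prop :=
  ∀ φ : ℝ → ℝ, ConcaveOn ℝ Set.univ φ →
    ∫ ω, φ (Z₁ ω) ∂μ ≤ ∫ ω, φ (Z₂ ω) ∂μ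

/-- Strict concave order `Z₁ ≺_ccv Z₂`. -/
def StrictConcaveOrder (Z₁ Z₂ : Xinf μ) : Prop :=
  ConcaveOrder Z₁ Z₂ ∧
    ∀ φ : ℝ → ℝ, StrictConcaveOn ℝ Set.univ φ →
      ∫ ω, φ (Z₁ ω) ∂μ < ∫ ω, φ (Z₂ ω) ∂μ

/-- Increasing concave order `Z₁ ⪯_icv Z₂`. -/
def IncConcaveOrder (Z₁ Z₂ : Xinf μ) : Prop :=
  ∀ φ : ℝ → ℝ, Monotone φ → ConcaveOn ℝ Set.univ φ →
    ∫ ω, φ (Z₁ ω) ∂μ ≤ ∫ ω, φ (Z₂ ω) ∂μ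

/-- Strict increasing concave order `Z₁ ≺_icv Z₂`. -/
def StrictIncConcaveOrder (Z₁ Z₂ : Xinf μ) : Prop :=
  IncConcaveOrder Z₁ Z₂ ∧
    ∀ φ : ℝ → ℝ, Monotone φ → StrictConcaveOn ℝ Set.univ φ →
      ∫ ω, φ (Z₁ ω) ∂μ < ∫ ω, φ (Z₂ ω) ∂μ

/-- Schur concavity. -/
def SchurConcave (U : Xinf μ → ℝ) : Prop :=
  ∀ Z₁ Z₂ : Xinf μ, ConcaveOrder Z₁ Z₂ → U Z₁ ≤ U Z₂

/-- Strict Schur concavity. -/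
def StrictSchurConcave (U : Xinf μ → ℝ) : Prop :=
  ∀ Z₁ Z₂ : Xinf μ, StrictConcaveOrder Z₁ Z₂ → U Z₁ < U Z₂

/-- S.S.D. preserving. -/
def SSDPreserving (U : Xinf μ → ℝ) : Prop :=
  ∀ Z₁ Z₂ : Xinf μ, IncConcaveOrder Z₁ Z₂ → U Z₁ ≤ U Z₂

/-- Strictly S.S.D. preserving. -/
def StrictSSDPreserving (U : Xinf μ → ℝ) : Prop :=
  ∀ Z₁ Z₂ : Xinf μ, StrictIncConcaveOrder Z₁ Z₂ → U Z₁ < U Z₂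

/-- A tuple of (pointwise defined) random variables is comonotone. -/
def ComonotoneFun {n : ℕ} (Z : Fin n → Ω → ℝ) : Prop :=
  ∀ i j ω₁ ω₂, 0 ≤ (Z i ω₁ - Z i ω₂) * (Z j ω₁ - Z j ω₂)

/-- A tuple of elements of `L^∞` is comonotone if some choice of representatives is. -/
def ComonotoneLp {n : ℕ} (Y : Fin n → Xinf μ) : Prop :=
  ∃ Z : Fin n → Ω → ℝ, (∀ i, (Y i : Ω → ℝ) =ᵐ[μ] Z i) ∧ ComonotoneFun Z

/-- Assumption 1 of the paper. -/
def Assumption1 {n : ℕ} (U : Fin n → Xinf μ → ℝ) : Prop :=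
  ∀ i (Z : Xinf μ),
    Continuous (fun c : ℝ => U i (Z + Lp.const ⊤ μ c)) ∧
    StrictMono (fun c : ℝ => U i (Z + Lp.const ⊤ μ c)) ∧
    Tendsto (fun c : ℝ => U i (Z + Lp.const ⊤ μ c)) atTop atTop

section Alloc

variable {n : ℕ} (U : Fin n → Xinf μ → ℝ) (X : Fin n → Xinf μ)

/-- Allocations of the aggregate endowment `∑ i, X i`. -/
def Alloc : Set (Fin n → Xinf μ) := {Y | ∑ i, Y i = ∑ i, X i}

/-- Individually rational allocations. -/
def IRset : Set (Fin n → Xinf μ) :=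
  {Y | Y ∈ Alloc X ∧ ∀ i, U i (X i) ≤ U i (Y i)}

/-- Pareto-optimal allocations. -/
def POset : Set (Fin n → Xinf μ) :=
  {Y | Y ∈ IRset U X ∧ ¬∃ Y' ∈ IRset U X,
    (∀ i, U i (Y i) ≤ U i (Y' i)) ∧ ∃ j, U j (Y j) < U j (Y' j)}

/-- Weakly Pareto-optimal allocations. -/
def WeakPOset : Set (Fin n → Xinf μ) :=
  {Y | Y ∈ IRset U X ∧ ¬∃ Y' ∈ IRset U X, ∀ i, U i (Y i) < U i (Y' i)}

/-- Comonotone allocations. -/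
def AllocC : Set (Fin n → Xinf μ) := {Y | Y ∈ Alloc X ∧ ComonotoneLp Y}

/-- Comonotone Pareto-optimal allocations. -/
def CPOset : Set (Fin n → Xinf μ) :=
  {Y | Y ∈ IRset U X ∧ ComonotoneLp Y ∧ ¬∃ Y' ∈ IRset U X, ComonotoneLp Y' ∧
    (∀ i, U i (Y i) ≤ U i (Y' i)) ∧ ∃ j, U j (Y j) < U j (Y' j)}

/-- Maximizers of the `λ`-weighted sum of utilities over IR allocations. -/
def SmaxSet (lam : Fin n → ℝ) : Set (Fin n → Xinf μ) :=
  {Y | Y ∈ IRset U X ∧ ∀ Y' ∈ IRset U X,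
    ∑ i, lam i * U i (Y' i) ≤ ∑ i, lam i * U i (Y i)}

/-- Maximizers of the `λ`-weighted sum of utilities over IR comonotone allocations. -/
def CSmaxSet (lam : Fin n → ℝ) : Set (Fin n → Xinf μ) :=
  {Y | Y ∈ IRset U X ∧ ComonotoneLp Y ∧ ∀ Y' ∈ IRset U X, ComonotoneLp Y' →
    ∑ i, lam i * U i (Y' i) ≤ ∑ i, lam i * U i (Y i)}

end Alloc



/-- A distortion function: a nondecreasing map of `[0,1]` into `[0,1]` with
`T 0 = 0` and `T 1 = 1` (encoded as a function on `ℝ`; only values on `[0,1]` matter). -/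
def IsDistortion (T : ℝ → ℝ) : Prop :=
  MonotoneOn T (Set.Icc 0 1) ∧ (∀ x ∈ Set.Icc (0:ℝ) 1, T x ∈ Set.Icc (0:ℝ) 1) ∧
    T 0 = 0 ∧ T 1 = 1

/-- A convex distortion function. -/
def IsConvexDistortion (T : ℝ → ℝ) : Prop :=
  IsDistortion T ∧ ConvexOn ℝ (Set.Icc 0 1) T

/-- A concave distortion function. -/
def IsConcaveDistortion (T : ℝ → ℝ) : Prop :=
  IsDistortion T ∧ ConcaveOn ℝ (Set.Icc 0 1) T

/-- Sequential closedness under pointwise convergence. -/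
def SeqClosedPointwise (𝒯 : Set (ℝ → ℝ)) : Prop :=
  ∀ (T : ℕ → ℝ → ℝ) (T' : ℝ → ℝ), (∀ k, T k ∈ 𝒯) →
    (∀ x, Tendsto (fun k => T k x) atTop (nhds (T' x))) → T' ∈ 𝒯

/-- The Choquet integral `∫ Z d(T ∘ μ)` of a random variable `Z` with respect to
the capacity `T ∘ μ`. -/
def choquet (μ : Measure Ω) (T : ℝ → ℝ) (Z : Ω → ℝ) : ℝ :=
  (∫ t in Set.Ioi (0:ℝ), T (μ {ω | t < Z ω}).toReal) +
    ∫ t in Set.Iio (0:ℝ), (T (μ {ω | t < Z ω}).toReal - 1)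

/-- Choquet integral of an element of `L^∞`. -/
def choquetLp (μ : Measure Ω) [IsProbabilityMeasure μ] (T : ℝ → ℝ) (Z : Lp ℝ ⊤ μ) : ℝ :=
  choquet μ T (Z : Ω → ℝ)

/-- The set `𝒢` of tuples of nondecreasing nonnegative functions on `ℝ₊` summing
to the identity. -/
def Gset (n : ℕ) : Set (Fin n → ℝ → ℝ) :=
  {g | (∀ i, MonotoneOn (g i) (Set.Ici 0)) ∧ (∀ i, ∀ x ≥ (0:ℝ), 0 ≤ g i x) ∧
    ∀ x ≥ (0:ℝ), ∑ i, g i x = x}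

/-- A pair of random variables is comonotone. -/
def ComonotonePair (Z S : Ω → ℝ) : Prop :=
  ∀ ω₁ ω₂, 0 ≤ (Z ω₁ - Z ω₂) * (S ω₁ - S ω₂)

def ComonotonePairLp (Z S : Lp ℝ ⊤ μ) : Prop :=
  ∃ Z' S' : Ω → ℝ, (Z : Ω → ℝ) =ᵐ[μ] Z' ∧ (S : Ω → ℝ) =ᵐ[μ] S' ∧ ComonotonePair Z' S'



/-- The essential infimum `s̲` of an element of `L^∞`. -/
def essInfS (S : Lp ℝ ⊤ μ) : ℝ := essInf (S : Ω → ℝ) μ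

/-- The tail probability `ℙ(S > s̲ + x)`. -/
def tailProbS (S : Lp ℝ ⊤ μ) (x : ℝ) : ℝ :=
  (μ {ω | essInfS S + x < S ω}).toReal

/-- The objective `(T_1,…,T_n) ↦ ∫_0^∞ max_i T_i(ℙ(S > s̲ + x)) dx`. -/
def JobjS {n : ℕ} (S : Lp ℝ ⊤ μ) (T : Fin n → ℝ → ℝ) : ℝ :=
  ∫ x in Set.Ioi (0:ℝ), ⨆ i, T i (tailProbS S x)

open Classical in
/-- The set `L_x` of agents attaining the maximum `max_j T_j(ℙ(S > s̲ + x))`. -/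
def Lset {n : ℕ} (S : Lp ℝ ⊤ μ) (T : Fin n → ℝ → ℝ) (x : ℝ) : Finset (Fin n) :=
  Finset.univ.filter (fun i => T i (tailProbS S x) = ⨆ j, T j (tailProbS S x))


/-- The discrete Choquet integral `∑_{k < K} v {k < f}` of a function `f` with values below `K`. -/
def layerSum {α : Type*} (v : Set α → ℝ) (K : ℕ) (f : α → ℕ) : ℝ :=
  ∑ k ∈ Finset.range K, v {x | k < f x}

theorem layerSum_neg {α : Type*} (v : Set α → ℝ) (K : ℕ) (f : α → ℕ) :
    layerSum (fun A => -v A) K f = -layerSum v K f := by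
  simp [layerSum]

theorem layerSum_mono {α : Type*} {v : Set α → ℝ} (hv : ∀ A B, A ⊆ B → v A ≤ v B) (K : ℕ)
    {f g : α → ℕ} (hfg : ∀ x, f x ≤ g x) : layerSum v K f ≤ layerSum v K g :=
  Finset.sum_le_sum fun _ _ => hv _ _ fun x hx => lt_of_lt_of_le hx (hfg x)

theorem layerSum_add_one_le {α : Type*} {v : Set α → ℝ} (hv0 : ∀ A, 0 ≤ v A)
    (hv1 : ∀ A, v A ≤ 1) (K : ℕ) (f : α → ℕ) :
    layerSum v K (fun x => f x + 1) ≤ layerSum v K f + 1 := by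
  rcases K with _ | K
  · simp [layerSum]
  · unfold layerSum
    rw [Finset.sum_range_succ', Finset.sum_range_succ]
    simp only [add_lt_add_iff_right]
    linarith [hv1 {x | 0 < f x + 1}, hv0 {x | K < f x}]

/-- Adding an indicator raises the discrete Choquet integral by at most the capacity of the set,
as soon as the capacity is submodular on the level sets involved. -/
theorem layerSum_add_indicator_le {α : Type*} {v : Set α → ℝ} (hv : v ∅ = 0) {K : ℕ}
    {f f' : α → ℕ} {A : Set α} (hf : ∀ x, f x < K)
    (hA : ∀ x ∈ A, f' x = f x + 1) (hA' : ∀ x ∉ A, f' x = f x)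
    (h : ∀ k, v ({x | k < f x} ∪ ({x | k ≤ f x} ∩ A)) + v ({x | k < f x} ∩ ({x | k ≤ f x} ∩ A)) ≤
      v {x | k < f x} + v ({x | k ≤ f x} ∩ A)) :
    layerSum v K f' ≤ layerSum v K f + v A := by
  have key : ∀ k, v {x | k < f' x} ≤ v {x | k < f x} -
      (v ({x | k + 1 ≤ f x} ∩ A) - v ({x | k ≤ f x} ∩ A)) := by
    intro k
    have h1 : {x | k < f' x} = {x | k < f x} ∪ ({x | k ≤ f x} ∩ A) := by
      ext x
      by_cases hx : x ∈ A
      · simp only [Set.mem_ofPred_eq, Set.mem_union, Set.mem_inter_iff, hx, hA x hx, and_true]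
        omega
      · simp [hx, hA' x hx]
    have h2 : {x | k < f x} ∩ ({x | k ≤ f x} ∩ A) = {x | k + 1 ≤ f x} ∩ A := by
      ext x
      simp only [Set.mem_ofPred_eq, Set.mem_inter_iff]
      constructor
      · rintro ⟨h, -, h'⟩; exact ⟨h, h'⟩
      · rintro ⟨h, h'⟩; exact ⟨h, Nat.le_of_succ_le h, h'⟩
    have := h k
    rw [h1]
    rw [h2] at this
    linarith
  have hK : {x | K ≤ f x} ∩ A = ∅ := by
    ext x
    simp only [Set.mem_inter_iff, Set.mem_ofPred_eq, Set.mem_empty_iff_false, iff_false, not_and]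
    intro h1
    exact absurd (hf x) (not_lt.2 h1)
  have h0 : {x | 0 ≤ f x} ∩ A = A := by
    ext x
    simp
  calc layerSum v K f' ≤ ∑ k ∈ Finset.range K, (v {x | k < f x} -
      (v ({x | k + 1 ≤ f x} ∩ A) - v ({x | k ≤ f x} ∩ A))) := Finset.sum_le_sum fun k _ => key k
    _ = layerSum v K f + v A := by
      rw [Finset.sum_sub_distrib, Finset.sum_range_sub (fun k => v ({x | k ≤ f x} ∩ A)), hK, h0, hv,
        layerSum]
      ring

theorem layerSum_add_le {α : Type*} {v : Set α → ℝ} (hv : v ∅ = 0) {K : ℕ}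
    {f g : α → ℕ} (hfg : ∀ x, f x + g x < K)
    (h : ∀ m k, v ({x | k < f x + min (g x) m} ∪ ({x | k ≤ f x + min (g x) m} ∩ {x | m < g x})) +
      v ({x | k < f x + min (g x) m} ∩ ({x | k ≤ f x + min (g x) m} ∩ {x | m < g x})) ≤
      v {x | k < f x + min (g x) m} + v ({x | k ≤ f x + min (g x) m} ∩ {x | m < g x})) :
    layerSum v K (fun x => f x + g x) ≤ layerSum v K f + layerSum v K g := by
  have key : ∀ m, layerSum v K (fun x => f x + min (g x) m) ≤
      layerSum v K f + ∑ k ∈ Finset.range m, v {x | k < g x} := by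
    intro m
    induction m with
    | zero => simp
    | succ m ih =>
      rw [Finset.sum_range_succ]
      have := layerSum_add_indicator_le (K := K) (f := fun x => f x + min (g x) m)
        (f' := fun x => f x + min (g x) (m + 1)) (A := {x | m < g x}) hv
        (fun x => by have := hfg x; omega)
        (fun x hx => by rw [Set.mem_ofPred_eq] at hx; omega)
        (fun x hx => by rw [Set.mem_ofPred_eq] at hx; omega) (h m)
      linarith
  have hmin : (fun x => f x + min (g x) K) = fun x => f x + g x := by
    funext x
    have := hfg x
    omega
  have := key K
  rwa [hmin] at this

theorem layerSum_add_of_comonotone {α : Type*} {v : Set α → ℝ} (hv : v ∅ = 0) {K : ℕ}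
    {f g : α → ℕ} (hfg : ∀ x, f x + g x < K) (hcom : ∀ x y, g x < g y → f x ≤ f y) :
    layerSum v K (fun x => f x + g x) = layerSum v K f + layerSum v K g := by
  have nested : ∀ m k,
      {x | k < f x + min (g x) m} ⊆ {x | k ≤ f x + min (g x) m} ∩ {x | m < g x} ∨
      {x | k ≤ f x + min (g x) m} ∩ {x | m < g x} ⊆ {x | k < f x + min (g x) m} := by
    intro m k
    by_contra! hne
    obtain ⟨⟨x, hx, hx'⟩, ⟨y, hy, hy'⟩⟩ := And.imp Set.not_subset.1 Set.not_subset.1 hne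
    simp only [Set.mem_ofPred_eq, Set.mem_inter_iff] at hx hx' hy hy'
    have := hcom x y
    omega
  have modular : ∀ A B : Set α, A ⊆ B ∨ B ⊆ A → v (A ∪ B) + v (A ∩ B) = v A + v B := by
    rintro A B (h | h)
    · rw [Set.union_eq_right.2 h, Set.inter_eq_left.2 h, add_comm]
    · rw [Set.union_eq_left.2 h, Set.inter_eq_right.2 h]
  apply le_antisymm
  · exact layerSum_add_le hv hfg fun m k => (modular _ _ (nested m k)).le
  · have := layerSum_add_le (v := fun A => -v A) (by simp [hv]) hfg
      fun m k => by have := modular _ _ (nested m k); linarith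
    simp only [layerSum_neg] at this
    linarith

theorem ConcaveOn.map_add_map_le_of_add_eq {T : ℝ → ℝ} {s : Set ℝ} (hT : ConcaveOn ℝ s T)
    {a b c d : ℝ} (ha : a ∈ s) (hd : d ∈ s) (hab : a ≤ b) (hac : a ≤ c) (h : a + d = b + c) :
    T a + T d ≤ T b + T c := by
  rcases eq_or_lt_of_le (show a ≤ d by linarith) with had | had
  · obtain rfl : b = a := by linarith
    obtain rfl : c = b := by linarith
    rw [had]
  · have hpos : 0 < d - a := sub_pos.2 had
    have e : (d - b) / (d - a) + (b - a) / (d - a) = 1 := by field_simp; ring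
    have n1 : 0 ≤ (d - b) / (d - a) := div_nonneg (by linarith) hpos.le
    have n2 : 0 ≤ (b - a) / (d - a) := div_nonneg (by linarith) hpos.le
    have h1 := hT.2 ha hd n1 n2 e
    have h2 := hT.2 ha hd n2 n1 (by rw [add_comm]; exact e)
    have eb : (d - b) / (d - a) * a + (b - a) / (d - a) * d = b := by field_simp; ring
    have ec : (b - a) / (d - a) * a + (d - b) / (d - a) * d = c := by
      obtain rfl : c = a + d - b := by linarith
      field_simp; ring
    simp only [smul_eq_mul] at h1 h2
    rw [eb] at h1
    rw [ec] at h2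
    linear_combination h1 + h2 - e * (T a + T d)

theorem IsDistortion.map_measureReal_mem {T : ℝ → ℝ} (hT : IsDistortion T) (A : Set Ω) :
    T (μ.real A) ∈ Set.Icc (0 : ℝ) 1 :=
  hT.2.1 _ ⟨measureReal_nonneg, measureReal_le_one⟩

theorem IsDistortion.map_measureReal_mono {T : ℝ → ℝ} (hT : IsDistortion T) {A B : Set Ω}
    (h : A ⊆ B) : T (μ.real A) ≤ T (μ.real B) :=
  hT.1 ⟨measureReal_nonneg, measureReal_le_one⟩ ⟨measureReal_nonneg, measureReal_le_one⟩
    (measureReal_mono h)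

theorem IsConcaveDistortion.submodular {T : ℝ → ℝ} (hT : IsConcaveDistortion T) {A B : Set Ω}
    (hB : MeasurableSet B) :
    T (μ.real (A ∪ B)) + T (μ.real (A ∩ B)) ≤ T (μ.real A) + T (μ.real B) := by
  rw [add_comm (T (μ.real (A ∪ B)))]
  refine hT.2.map_add_map_le_of_add_eq ⟨measureReal_nonneg, measureReal_le_one⟩
    ⟨measureReal_nonneg, measureReal_le_one⟩ (measureReal_mono Set.inter_subset_left)
    (measureReal_mono Set.inter_subset_right) ?_
  rw [add_comm, measureReal_union_add_inter hB]

theorem IsDistortion.antitone_tail {T : ℝ → ℝ} (hT : IsDistortion T) (Z : Ω → ℝ) :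
    Antitone fun t : ℝ => T (μ.real {ω | t < Z ω}) :=
  fun _ _ hst => hT.map_measureReal_mono fun _ hω => lt_of_le_of_lt hst hω

theorem choquet_congr_ae {α : Type*} [MeasurableSpace α] {ν : Measure α} (T : ℝ → ℝ)
    {Z W : α → ℝ} (h : Z =ᵐ[ν] W) :
    choquet ν T Z = choquet ν T W := by
  have : ∀ t : ℝ, ν {ω | t < Z ω} = ν {ω | t < W ω} := fun t =>
    measure_congr (h.mono fun ω hω => by
      change (t < Z ω) = (t < W ω)
      rw [hω])
  simp only [choquet, this]

theorem choquet_eq_intervalIntegral {T : ℝ → ℝ} (hT : IsDistortion T) {Z : Ω → ℝ} {M L : ℝ}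
    (hM : 0 ≤ M) (hZ : ∀ ω, |Z ω| ≤ M) (hL : M ≤ L) :
    choquet μ T Z = (∫ t in (-M)..L, T (μ.real {ω | t < Z ω})) - M := by
  have hint : ∀ a b : ℝ, IntervalIntegrable (fun t => T (μ.real {ω | t < Z ω})) volume a b :=
    fun a b => (hT.antitone_tail Z).intervalIntegrable
  have h1 : ∀ t, L < t → T (μ.real {ω | t < Z ω}) = 0 := by
    intro t ht
    have : {ω | t < Z ω} = ∅ := by
      ext ω
      simp only [Set.mem_ofPred_eq, Set.mem_empty_iff_false, iff_false, not_lt]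
      linarith [(abs_le.1 (hZ ω)).2]
    rw [this, measureReal_empty, hT.2.2.1]
  have h2 : ∀ t, t < -M → T (μ.real {ω | t < Z ω}) = 1 := by
    intro t ht
    have : {ω | t < Z ω} = Set.univ := by
      ext ω
      simp only [Set.mem_ofPred_eq, Set.mem_univ, iff_true]
      linarith [(abs_le.1 (hZ ω)).1]
    rw [this, probReal_univ, hT.2.2.2]
  have e1 : ∫ t in Set.Ioi (0 : ℝ), T (μ.real {ω | t < Z ω}) =
      ∫ t in (0 : ℝ)..L, T (μ.real {ω | t < Z ω}) := by
    rw [intervalIntegral.integral_of_le (hM.trans hL)]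
    refine setIntegral_eq_of_subset_of_forall_sdiff_eq_zero measurableSet_Ioi
      Set.Ioc_subset_Ioi_self fun t ht => h1 t ?_
    by_contra! h
    exact ht.2 ⟨ht.1, h⟩
  have e2 : ∫ t in Set.Iio (0 : ℝ), (T (μ.real {ω | t < Z ω}) - 1) =
      ∫ t in (-M)..0, (T (μ.real {ω | t < Z ω}) - 1) := by
    rw [intervalIntegral.integral_of_le (by linarith), integral_Ioc_eq_integral_Ioo,
      ← integral_Ico_eq_integral_Ioo]
    refine setIntegral_eq_of_subset_of_forall_sdiff_eq_zero measurableSet_Iio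
      Set.Ico_subset_Iio_self fun t ht => ?_
    rw [h2 t, sub_self]
    by_contra! h
    exact ht.2 ⟨h, ht.1⟩
  change (∫ t in Set.Ioi (0 : ℝ), T (μ.real {ω | t < Z ω})) +
    ∫ t in Set.Iio (0 : ℝ), (T (μ.real {ω | t < Z ω}) - 1) = _
  rw [e1, e2, intervalIntegral.integral_sub (hint _ _) (by simp),
    ← intervalIntegral.integral_add_adjacent_intervals (hint (-M) 0) (hint 0 L)]
  simp
  ring

/-- The discrete Choquet integral of `⌈N (Z + M)⌉` approximates `N` times the Choquet integral of
`Z + M` up to an error of at most one. -/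
theorem choquet_layerSum_bounds {T : ℝ → ℝ} (hT : IsDistortion T) {Z : Ω → ℝ} {M : ℝ}
    (hM : 0 ≤ M) (hZ : ∀ ω, |Z ω| ≤ M) {N K : ℕ} (hN : 0 < N) (hK : 2 * M * N ≤ K) :
    N * (choquet μ T Z + M) ≤
        layerSum (fun A => T (μ.real A)) K (fun ω => ⌈N * (Z ω + M)⌉₊) ∧
      layerSum (fun A => T (μ.real A)) K (fun ω => ⌈N * (Z ω + M)⌉₊) ≤
        N * (choquet μ T Z + M) + 1 := by
  have hN' : (0 : ℝ) < N := Nat.cast_pos.2 hN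
  set φ : ℝ → ℝ := fun t => T (μ.real {ω | t < Z ω}) with hφ
  set ψ : ℝ → ℝ := fun s => φ (s / N - M) with hψ
  have hanti : Antitone ψ := fun s t hst =>
    hT.antitone_tail Z (sub_le_sub_right (div_le_div_of_nonneg_right hst hN'.le) M)
  have hint : ∫ s in (0 : ℝ)..K, ψ s = N * (choquet μ T Z + M) := by
    rw [hψ, intervalIntegral.integral_comp_div_sub φ hN'.ne',
      choquet_eq_intervalIntegral hT hM hZ (L := K / N - M)]
    · simp [hφ]
    · rw [le_sub_iff_add_le, le_div_iff₀ hN']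
      linarith
  have hsum : layerSum (fun A => T (μ.real A)) K (fun ω => ⌈N * (Z ω + M)⌉₊) =
      ∑ k ∈ Finset.range K, ψ k := by
    refine Finset.sum_congr rfl fun k _ => ?_
    have : {ω | k < ⌈N * (Z ω + M)⌉₊} = {ω | (k : ℝ) / N - M < Z ω} := by
      ext ω
      simp only [Set.mem_ofPred_eq, Nat.lt_ceil, sub_lt_iff_lt_add, div_lt_iff₀' hN']
    simp only [this, hψ, hφ]
  have up := AntitoneOn.integral_le_sum (x₀ := 0) (a := K) (hanti.antitoneOn _)
  have lo := AntitoneOn.sum_le_integral (x₀ := 0) (a := K) (hanti.antitoneOn _)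
  simp only [zero_add] at up lo
  rw [hint] at up lo
  have shift : ∑ k ∈ Finset.range K, ψ ((k + 1 : ℕ) : ℝ) =
      ∑ k ∈ Finset.range K, ψ k + ψ K - ψ 0 := by
    have h := Finset.sum_range_succ' (fun k : ℕ => ψ k) K
    rw [Finset.sum_range_succ] at h
    simp only [Nat.cast_zero] at h
    linarith
  have h0 : ψ 0 ≤ 1 := (hT.map_measureReal_mem _).2
  have h1 : 0 ≤ ψ K := (hT.map_measureReal_mem _).1
  rw [hsum]
  exact ⟨up, by linarith⟩

theorem le_of_forall_nat_mul_le_add {a b c : ℝ} (h : ∀ N : ℕ, 0 < N → N * a ≤ N * b + c) :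
    a ≤ b := by
  by_contra! hlt
  obtain ⟨N, hN⟩ := exists_nat_gt (|c| / (a - b))
  have hpos : 0 < a - b := sub_pos.2 hlt
  have hN0 : (0 : ℝ) < N := lt_of_le_of_lt (by positivity) hN
  rw [div_lt_iff₀ hpos] at hN
  have := h N (Nat.cast_pos.1 hN0)
  linarith [le_abs_self c]

theorem ceil_add_ceil_lt {α : Type*} {f g : α → ℝ} {M₁ M₂ : ℝ} {N : ℕ}
    (hf : ∀ ω, |f ω| ≤ M₁) (hg : ∀ ω, |g ω| ≤ M₂) (ω : α) :
    ⌈N * (f ω + M₁)⌉₊ + ⌈N * (g ω + M₂)⌉₊ < ⌈2 * (M₁ + M₂) * N⌉₊ + 3 ∧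
    ⌈N * ((f + g) ω + (M₁ + M₂))⌉₊ ≤ ⌈N * (f ω + M₁)⌉₊ + ⌈N * (g ω + M₂)⌉₊ ∧
    ⌈N * (f ω + M₁)⌉₊ + ⌈N * (g ω + M₂)⌉₊ ≤ ⌈N * ((f + g) ω + (M₁ + M₂))⌉₊ + 1 := by
  obtain ⟨hf1, hf2⟩ := abs_le.1 (hf ω)
  obtain ⟨hg1, hg2⟩ := abs_le.1 (hg ω)
  have hN : (0 : ℝ) ≤ N := Nat.cast_nonneg N
  have hx : (0 : ℝ) ≤ N * (f ω + M₁) := mul_nonneg hN (by linarith)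
  have hy : (0 : ℝ) ≤ N * (g ω + M₂) := mul_nonneg hN (by linarith)
  have hx' : N * (f ω + M₁) ≤ N * (2 * M₁) := mul_le_mul_of_nonneg_left (by linarith) hN
  have hy' : N * (g ω + M₂) ≤ N * (2 * M₂) := mul_le_mul_of_nonneg_left (by linarith) hN
  have hsum : N * ((f + g) ω + (M₁ + M₂)) = N * (f ω + M₁) + N * (g ω + M₂) := by
    rw [Pi.add_apply]; ring
  have cx := Nat.ceil_lt_add_one hx
  have cy := Nat.ceil_lt_add_one hy
  refine ⟨?_, ?_, ?_⟩
  · have := Nat.le_ceil (2 * (M₁ + M₂) * N)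
    rw [← Nat.cast_lt (α := ℝ)]
    push_cast
    linarith
  · rw [hsum]
    exact Nat.ceil_add_le _ _
  · have := Nat.le_ceil (N * ((f + g) ω + (M₁ + M₂)))
    rw [← Nat.lt_succ_iff, ← Nat.cast_lt (α := ℝ)]
    push_cast
    linarith

theorem abs_add_apply_le {α : Type*} {f g : α → ℝ} {M₁ M₂ : ℝ}
    (hf : ∀ ω, |f ω| ≤ M₁) (hg : ∀ ω, |g ω| ≤ M₂) (ω : α) :
    |(f + g) ω| ≤ M₁ + M₂ :=
  (abs_add_le _ _).trans (add_le_add (hf ω) (hg ω))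

section Pair

variable {T : ℝ → ℝ} {f g : Ω → ℝ} {M₁ M₂ : ℝ}

theorem choquet_add_le (hT : IsConcaveDistortion T) (hM₁ : 0 ≤ M₁) (hM₂ : 0 ≤ M₂)
    (hf : ∀ ω, |f ω| ≤ M₁) (hg : ∀ ω, |g ω| ≤ M₂) (hfm : Measurable f) (hgm : Measurable g) :
    choquet μ T (f + g) ≤ choquet μ T f + choquet μ T g := by
  refine le_of_forall_nat_mul_le_add (c := 2) fun N hN => ?_
  set K : ℕ := ⌈2 * (M₁ + M₂) * N⌉₊ + 3 with hKdef
  have hK : 2 * (M₁ + M₂) * N ≤ K := by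
    rw [hKdef]; push_cast; linarith [Nat.le_ceil (2 * (M₁ + M₂) * N)]
  have hN' : (0 : ℝ) ≤ N := Nat.cast_nonneg N
  have p1 : 0 ≤ M₁ * N := by positivity
  have p2 : 0 ≤ M₂ * N := by positivity
  have bf := (choquet_layerSum_bounds (μ := μ) hT.1 hM₁ hf hN (K := K) (by linarith)).2
  have bg := (choquet_layerSum_bounds (μ := μ) hT.1 hM₂ hg hN (K := K) (by linarith)).2
  have bs := (choquet_layerSum_bounds (μ := μ) hT.1 (add_nonneg hM₁ hM₂)
    (abs_add_apply_le hf hg) hN hK).1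
  have hF : Measurable fun ω => ⌈N * (f ω + M₁)⌉₊ :=
    Nat.measurable_ceil.comp ((hfm.add_const _).const_mul _)
  have hG : Measurable fun ω => ⌈N * (g ω + M₂)⌉₊ :=
    Nat.measurable_ceil.comp ((hgm.add_const _).const_mul _)
  have mono := layerSum_mono (v := fun A => T (μ.real A))
    (fun A B h => hT.1.map_measureReal_mono h) K
    fun ω => (ceil_add_ceil_lt (N := N) hf hg ω).2.1
  have sub := layerSum_add_le (v := fun A => T (μ.real A)) (K := K)
    (f := fun ω => ⌈N * (f ω + M₁)⌉₊) (g := fun ω => ⌈N * (g ω + M₂)⌉₊)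
    (by simp [hT.1.2.2.1]) (fun ω => (ceil_add_ceil_lt hf hg ω).1)
    (fun m k => hT.submodular
      ((measurableSet_le measurable_const (hF.add (hG.min measurable_const))).inter
        (measurableSet_lt measurable_const hG)))
  linarith

theorem le_choquet_add_of_comonotone (hT : IsDistortion T) (hM₁ : 0 ≤ M₁) (hM₂ : 0 ≤ M₂)
    (hf : ∀ ω, |f ω| ≤ M₁) (hg : ∀ ω, |g ω| ≤ M₂) (hcom : ComonotonePair f g) :
    choquet μ T f + choquet μ T g ≤ choquet μ T (f + g) := by
  refine le_of_forall_nat_mul_le_add (c := 2) fun N hN => ?_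
  set K : ℕ := ⌈2 * (M₁ + M₂) * N⌉₊ + 3 with hKdef
  have hK : 2 * (M₁ + M₂) * N ≤ K := by
    rw [hKdef]; push_cast; linarith [Nat.le_ceil (2 * (M₁ + M₂) * N)]
  have hN' : (0 : ℝ) ≤ N := Nat.cast_nonneg N
  have p1 : 0 ≤ M₁ * N := by positivity
  have p2 : 0 ≤ M₂ * N := by positivity
  have bf := (choquet_layerSum_bounds (μ := μ) hT hM₁ hf hN (K := K) (by linarith)).1
  have bg := (choquet_layerSum_bounds (μ := μ) hT hM₂ hg hN (K := K) (by linarith)).1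
  have bs := (choquet_layerSum_bounds (μ := μ) hT (add_nonneg hM₁ hM₂)
    (abs_add_apply_le hf hg) hN hK).2
  have mono := layerSum_mono (v := fun A => T (μ.real A))
    (fun A B h => hT.map_measureReal_mono h) K
    fun ω => (ceil_add_ceil_lt (N := N) hf hg ω).2.2
  have one := layerSum_add_one_le (v := fun A => T (μ.real A))
    (fun A => (hT.map_measureReal_mem A).1) (fun A => (hT.map_measureReal_mem A).2) K
    fun ω => ⌈N * ((f + g) ω + (M₁ + M₂))⌉₊
  have add := layerSum_add_of_comonotone (v := fun A => T (μ.real A)) (K := K)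
    (f := fun ω => ⌈N * (f ω + M₁)⌉₊) (g := fun ω => ⌈N * (g ω + M₂)⌉₊)
    (by simp [hT.2.2.1]) (fun ω => (ceil_add_ceil_lt hf hg ω).1) (by
      intro x y hxy
      have hlt : g x < g y := by
        by_contra! h
        exact absurd hxy (not_lt.2
          (Nat.ceil_mono (mul_le_mul_of_nonneg_left (by linarith) hN')))
      have hle : f x ≤ f y := by
        have := hcom x y
        by_contra! h
        nlinarith
      exact Nat.ceil_mono (mul_le_mul_of_nonneg_left (by linarith) hN'))
  linarith

end Pair

theorem Xinf.exists_ae_abs_le {α : Type*} [MeasurableSpace α] {ν : Measure α} (Z : Xinf ν) :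
    ∃ M : ℝ, 0 ≤ M ∧ ∀ᵐ ω ∂ν, |Z ω| ≤ M := by
  refine ⟨(eLpNorm Z ⊤ ν).toReal, ENNReal.toReal_nonneg, ?_⟩
  rw [eLpNorm_exponent_top]
  have hfin : eLpNormEssSup Z ν ≠ ⊤ := by
    rw [← eLpNorm_exponent_top]
    exact Lp.eLpNorm_ne_top Z
  filter_upwards [ae_le_eLpNormEssSup (f := Z) (μ := ν)] with ω hω
  have := ENNReal.toReal_mono hfin hω
  simpa using this

theorem abs_clamp_le {M : ℝ} (hM : 0 ≤ M) (x : ℝ) : |max (-M) (min M x)| ≤ M :=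
  abs_le.2 ⟨le_max_left _ _, max_le (by linarith) (min_le_left _ _)⟩

theorem clamp_eq_of_abs_le {M x : ℝ} (h : |x| ≤ M) : max (-M) (min M x) = x := by
  rw [min_eq_right (abs_le.1 h).2, max_eq_right (abs_le.1 h).1]

theorem monotone_clamp (M : ℝ) : Monotone fun x : ℝ => max (-M) (min M x) :=
  fun _ _ h => max_le_max le_rfl (min_le_min le_rfl h)

/-- Comonotonicity is preserved under nondecreasing transformations. -/
theorem ComonotonePair.comp_monotone {α : Type*} {f g : α → ℝ} (h : ComonotonePair f g)
    {p q : ℝ → ℝ} (hp : Monotone p) (hq : Monotone q) : ComonotonePair (p ∘ f) (q ∘ g) := by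
  intro x y
  have key : ∀ x y, f x ≤ f y → g x ≤ g y → 0 ≤ (p (f x) - p (f y)) * (q (g x) - q (g y)) :=
    fun x y h1 h2 => mul_nonneg_of_nonpos_of_nonpos (sub_nonpos.2 (hp h1)) (sub_nonpos.2 (hq h2))
  have key' : 0 ≤ (p (f x) - p (f y)) * (q (g x) - q (g y)) := by
    rcases lt_trichotomy (f x) (f y) with h1 | h1 | h1
    · exact key x y h1.le (by by_contra! h2; nlinarith [h x y])
    · simp [h1]
    · linarith [key y x h1.le (by by_contra! h2; nlinarith [h x y])]
  exact key'

theorem choquetLp_add_le {T : ℝ → ℝ} (hT : IsConcaveDistortion T) (Z W : Xinf μ) :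
    choquetLp μ T (Z + W) ≤ choquetLp μ T Z + choquetLp μ T W := by
  obtain ⟨M₁, hM₁, h₁⟩ := Xinf.exists_ae_abs_le Z
  obtain ⟨M₂, hM₂, h₂⟩ := Xinf.exists_ae_abs_le W
  set f : Ω → ℝ := fun ω => max (-M₁) (min M₁ (Z ω))
  set g : Ω → ℝ := fun ω => max (-M₂) (min M₂ (W ω))
  have hf : (Z : Ω → ℝ) =ᵐ[μ] f := h₁.mono fun ω hω => (clamp_eq_of_abs_le hω).symm
  have hg : (W : Ω → ℝ) =ᵐ[μ] g := h₂.mono fun ω hω => (clamp_eq_of_abs_le hω).symm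
  unfold choquetLp
  rw [choquet_congr_ae T ((Lp.coeFn_add Z W).trans (hf.add hg)), choquet_congr_ae T hf,
    choquet_congr_ae T hg]
  exact choquet_add_le hT hM₁ hM₂ (fun ω => abs_clamp_le hM₁ _) (fun ω => abs_clamp_le hM₂ _)
    (measurable_const.max (measurable_const.min (Lp.stronglyMeasurable Z).measurable))
    (measurable_const.max (measurable_const.min (Lp.stronglyMeasurable W).measurable))

theorem le_choquetLp_add_of_comonotone {T : ℝ → ℝ} (hT : IsDistortion T) {Z W : Xinf μ}
    (h : ComonotonePairLp Z W) :
    choquetLp μ T Z + choquetLp μ T W ≤ choquetLp μ T (Z + W) := by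
  obtain ⟨Z', W', hZ, hW, hcom⟩ := h
  obtain ⟨M₁, hM₁, h₁⟩ := Xinf.exists_ae_abs_le Z
  obtain ⟨M₂, hM₂, h₂⟩ := Xinf.exists_ae_abs_le W
  have hf : (Z : Ω → ℝ) =ᵐ[μ] (fun x => max (-M₁) (min M₁ x)) ∘ Z' := by
    filter_upwards [hZ, h₁] with ω hω hω'
    rw [Function.comp_apply, ← hω, clamp_eq_of_abs_le hω']
  have hg : (W : Ω → ℝ) =ᵐ[μ] (fun x => max (-M₂) (min M₂ x)) ∘ W' := by
    filter_upwards [hW, h₂] with ω hω hω'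
    rw [Function.comp_apply, ← hω, clamp_eq_of_abs_le hω']
  unfold choquetLp
  rw [choquet_congr_ae T ((Lp.coeFn_add Z W).trans (hf.add hg)), choquet_congr_ae T hf,
    choquet_congr_ae T hg]
  exact le_choquet_add_of_comonotone hT hM₁ hM₂ (fun ω => abs_clamp_le hM₁ _)
    (fun ω => abs_clamp_le hM₂ _) (hcom.comp_monotone (monotone_clamp M₁) (monotone_clamp M₂))

theorem choquetLp_zero {T : ℝ → ℝ} (hT : IsDistortion T) : choquetLp μ T 0 = 0 := by
  unfold choquetLp
  rw [choquet_congr_ae T (Lp.coeFn_zero ℝ ⊤ μ),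
    choquet_eq_intervalIntegral hT le_rfl (by simp) le_rfl]
  simp

theorem sum_choquetLp_le_of_comonotone {T : ℝ → ℝ} (hT : IsDistortion T) {n : ℕ}
    {Y : Fin n → Xinf μ} (h : ComonotoneLp Y) :
    ∑ i, choquetLp μ T (Y i) ≤ choquetLp μ T (∑ i, Y i) := by
  obtain ⟨Z, hZ, hcom⟩ := h
  have hrep : ∀ s : Finset (Fin n), ((∑ i ∈ s, Y i : Xinf μ) : Ω → ℝ) =ᵐ[μ] ∑ i ∈ s, Z i := by
    intro s
    induction s using Finset.induction_on with
    | empty => simpa using Lp.coeFn_zero ℝ ⊤ μ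
    | insert j s hj ih =>
      rw [Finset.sum_insert hj, Finset.sum_insert hj]
      exact (Lp.coeFn_add _ _).trans ((hZ j).add ih)
  have hle : ∀ s : Finset (Fin n),
      ∑ i ∈ s, choquetLp μ T (Y i) ≤ choquetLp μ T (∑ i ∈ s, Y i) := by
    intro s
    induction s using Finset.induction_on with
    | empty => simp [choquetLp_zero hT]
    | insert j s hj ih =>
      rw [Finset.sum_insert hj, Finset.sum_insert hj]
      refine (add_le_add_right ih _).trans
        (le_choquetLp_add_of_comonotone hT ⟨Z j, ∑ i ∈ s, Z i, hZ j, hrep s, fun x y => ?_⟩)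
      rw [Finset.sum_apply, Finset.sum_apply, ← Finset.sum_sub_distrib, Finset.mul_sum]
      exact Finset.sum_nonneg fun i _ => hcom j i x y
  exact hle Finset.univ

/-- If every agent uses the same coherent distortion risk measure, every
individually rational comonotone allocation of the aggregate risk is Pareto optimal. -/
theorem same_risk_measure_IR_comonotone_is_PO
    (hatomless : AtomlessMeasure μ) {n : ℕ} (hn : 0 < n)
    (X : Fin n → Xinf μ) (hX : ∀ i, 0 ≤ X i)
    (T : ℝ → ℝ) (hT : IsConcaveDistortion T)
    (ρ : Xinf μ → ℝ) (hρ : ∀ Z, ρ Z = choquetLp μ T Z)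
    (Y : Fin n → Xinf μ)
    (hY : ∑ i, Y i = ∑ i, X i) (hIR : ∀ i, ρ (Y i) ≤ ρ (X i))
    (hcom : ComonotoneLp Y) :
    ¬∃ Y' : Fin n → Xinf μ, (∑ i, Y' i = ∑ i, X i) ∧ (∀ i, ρ (Y' i) ≤ ρ (X i)) ∧
      (∀ i, ρ (Y' i) ≤ ρ (Y i)) ∧ ∃ j, ρ (Y' j) < ρ (Y j) := by
  rintro ⟨Y', hY', -, hle, j, hj⟩
  simp only [hρ] at hle hj
  have hlt : ∑ i, choquetLp μ T (Y' i) < ∑ i, choquetLp μ T (Y i) :=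
    Finset.sum_lt_sum (fun i _ => hle i) ⟨j, Finset.mem_univ j, hj⟩
  have hsub : choquetLp μ T (∑ i, Y' i) ≤ ∑ i, choquetLp μ T (Y' i) :=
    Finset.le_sum_of_subadditive _ (choquetLp_zero hT.1).le (choquetLp_add_le hT) _ _
  have hadd := sum_choquetLp_le_of_comonotone hT.1 hcom
  rw [hY', ← hY] at hsub
  exact absurd (hadd.trans hsub) (not_le.2 hlt)

end
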